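/- Let C be a nonempty finite type, w : C → ℕ a weight function, and p : ℕ → C → ℕ a sequence of maps such that (refinement) for all i and all x y : C, p (i+1) x = p (i+1) y implies p i x = p i y, and (largest-block reuse) for all i and all x : C, either p (i+1) x = p i x or 2 * Fintype.card {y : C // p (i+1) y = p (i+1) x} ≤ Fintype.card {y : C // p i y = p i x}. Then for every k, ∑_{i < k} ∑_{x : C, p (i+1) x ≠ p i x} w x ≤ (∑_{x : C} w x) * Nat.log 2 (Fintype.card C). -/

import Mathlib

/-- Each change of the label of `x` halves its block, so the number of changes is controlled by
the size of the current block. -/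
theorem two_pow_card_changes_mul_card_block_le {C : Type*} [Fintype C] (p : ℕ → C → ℕ) (x : C)
    (hrefine : ∀ i, ∀ y : C, p (i + 1) y = p (i + 1) x → p i y = p i x)
    (hreuse : ∀ i, p (i + 1) x = p i x ∨
      2 * Fintype.card {y : C // p (i + 1) y = p (i + 1) x} ≤
        Fintype.card {y : C // p i y = p i x}) (k : ℕ) :
    2 ^ ((Finset.range k).filter (fun i => p (i + 1) x ≠ p i x)).card *
      Fintype.card {y : C // p k y = p k x} ≤ Fintype.card C := by
  induction k with
  | zero => simpa using Fintype.card_subtype_le fun y => p 0 y = p 0 x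
  | succ k ih =>
    refine le_trans ?_ ih
    rw [Finset.range_add_one, Finset.filter_insert]
    split_ifs with h
    · rw [Finset.card_insert_of_notMem (by simp), pow_succ, mul_assoc]
      exact Nat.mul_le_mul_left _ ((hreuse k).resolve_left h)
    · exact Nat.mul_le_mul_left _ (Fintype.card_subtype_mono _ _ (hrefine k))

theorem weighted_dirty_markings_bound {C : Type*} [Fintype C] [Nonempty C]
    (w : C → ℕ) (p : ℕ → C → ℕ)
    (hrefine : ∀ i, ∀ x y : C, p (i + 1) x = p (i + 1) y → p i x = p i y)
    (hreuse : ∀ i, ∀ x : C,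
      p (i + 1) x = p i x ∨
      2 * Fintype.card {y : C // p (i + 1) y = p (i + 1) x} ≤
        Fintype.card {y : C // p i y = p i x}) :
    ∀ k : ℕ,
      ∑ i ∈ Finset.range k,
          ∑ x ∈ Finset.univ.filter (fun x : C => p (i + 1) x ≠ p i x), w x ≤
        (∑ x : C, w x) * Nat.log 2 (Fintype.card C) := by
  intro k
  simp_rw [Finset.sum_filter]
  rw [Finset.sum_comm, Finset.sum_mul]
  refine Finset.sum_le_sum fun x _ => ?_
  rw [← Finset.sum_filter, Finset.sum_const, smul_eq_mul, mul_comm]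
  refine Nat.mul_le_mul_left _ (Nat.le_log_of_pow_le one_lt_two ?_)
  have hblock : 0 < Fintype.card {y : C // p k y = p k x} := Fintype.card_pos_iff.2 ⟨⟨x, rfl⟩⟩
  exact (Nat.le_mul_of_pos_right _ hblock).trans
    (two_pow_card_changes_mul_card_block_le p x (fun i y => hrefine i y x)
      (fun i => hreuse i x) k)
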